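/- arXiv:0910.2997 — 2 statements merged into one kernel-verified Lean document; each statement's English description precedes it below -/
import Mathlib

section
/- Every weakly holomorphic modular form f of weight k on SL_2(ℤ) satisfies ord_∞(f) ≤ ℓ, where k = 12ℓ + k' with k' ∈ {0,4,6,8,10,14}. -/
open UpperHalfPlane Complex CongruenceSubgroup MatrixGroups
open scoped ModularForm Real MatrixGroups Manifold

noncomputable section

/-- `q = e^{2 π i τ}`. -/
def qexp (τ : UpperHalfPlane) : ℂ := Complex.exp (2 * π * Complex.I * τ)

/-- `f` has the `q`-expansion `∑ c n qⁿ` at `∞`, with only finitely many negative terms. -/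
def HasExpansion (f : UpperHalfPlane → ℂ) (c : ℤ → ℂ) : Prop :=
  (∃ N : ℤ, ∀ n : ℤ, n < N → c n = 0) ∧
    ∀ τ : UpperHalfPlane, HasSum (fun n : ℤ => c n * qexp τ ^ n) (f τ)

/-- Weakly holomorphic modular forms of weight `k` on `Γ`, together with their
Fourier coefficients. -/
structure WhmForm (Γ : Subgroup SL(2, ℤ)) (k : ℤ) where
  toFun : UpperHalfPlane → ℂ
  coeff : ℤ → ℂ
  holo : MDifferentiable 𝓘(ℂ) 𝓘(ℂ) toFun
  slash_eq : ∀ γ ∈ Γ, toFun ∣[k] γ = toFun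
  expansion : HasExpansion toFun coeff

/-- `f = q^{-m} + O(q^{ℓ+1})`. -/
def IsBasisElt {Γ : Subgroup SL(2, ℤ)} (k ℓ m : ℤ) (f : WhmForm Γ k) : Prop :=
  f.coeff (-m) = 1 ∧ ∀ n : ℤ, n ≠ -m → n ≤ ℓ → f.coeff n = 0

/-- multiplication of a point of the upper half plane by a positive real number. -/
def rscale (a : ℝ) (ha : 0 < a) (τ : UpperHalfPlane) : UpperHalfPlane :=
  ⟨a * τ, by simpa [Complex.mul_im] using mul_pos ha τ.2⟩

/-- `τ ↦ -1/τ` on the upper half plane. -/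
def neginv (τ : UpperHalfPlane) : UpperHalfPlane :=
  ⟨(-(τ : ℂ))⁻¹, τ.im_inv_neg_coe_pos⟩

lemma qexp_ne_zero (τ : UpperHalfPlane) : qexp τ ≠ 0 := Complex.exp_ne_zero _

lemma norm_qexp (τ : UpperHalfPlane) : ‖qexp τ‖ = Real.exp (-(2 * π * τ.im)) := by
  simp [qexp, Complex.norm_exp]

/-- A `q`-expansion supported on exponents `≥ m` is `O(q ^ m)` at infinity. -/
lemma HasExpansion.isBoundedAtImInfty_mul_qexp_zpow {f : UpperHalfPlane → ℂ} {c : ℤ → ℂ}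
    (h : HasExpansion f c) {m : ℤ} (hm : ∀ n < m, c n = 0) :
    IsBoundedAtImInfty (fun τ ↦ f τ * qexp τ ^ (-m)) := by
  have hI := (h.2 I).summable.norm.mul_right ‖qexp I ^ (-m)‖
  rw [isBoundedAtImInfty_iff]
  refine ⟨_, 1, fun τ hτ ↦ tsum_of_norm_bounded hI.hasSum (f := fun n ↦ c n * qexp τ ^ n *
    qexp τ ^ (-m)) ?_ |>.trans_eq' ?_⟩
  · intro n
    rcases lt_or_ge n m with hn | hn
    · simp [hm n hn]
    · obtain ⟨j, rfl⟩ := Int.le.dest hn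
      have hq : ∀ σ : UpperHalfPlane, qexp σ ^ (m + (j : ℤ)) * qexp σ ^ (-m) = qexp σ ^ j := by
        intro σ
        rw [← zpow_add₀ (qexp_ne_zero σ)]
        simp
      rw [← norm_mul, mul_assoc, mul_assoc, hq, hq, norm_mul, norm_mul, norm_pow, norm_pow,
        norm_qexp, norm_qexp]
      gcongr
      simpa using hτ
  · rw [((h.2 τ).mul_right _).tsum_eq]

lemma discriminant_smul (γ : SL(2, ℤ)) (z : UpperHalfPlane) :
    ModularForm.discriminant (γ • z) * denom γ z ^ (-12 : ℤ) = ModularForm.discriminant z := by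
  have h := congrFun (SlashInvariantForm.slash_action_generators_SL2Z
    ModularForm.discriminant_S_invariant ModularForm.discriminant_T_invariant γ) z
  rwa [ModularForm.SL_slash_apply] at h

lemma slash_mul_discriminant_zpow {k : ℤ} {f : UpperHalfPlane → ℂ} {γ : SL(2, ℤ)}
    (hf : f ∣[k] γ = f) (m : ℤ) :
    (fun τ ↦ f τ * ModularForm.discriminant τ ^ (-m)) ∣[k - 12 * m] γ =
      fun τ ↦ f τ * ModularForm.discriminant τ ^ (-m) := by
  ext z
  have h := congrFun hf z
  rw [ModularForm.SL_slash_apply] at h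
  rw [ModularForm.SL_slash_apply, ← h, ← discriminant_smul γ z, mul_zpow, ← zpow_mul,
    show -(k - 12 * m) = -k + -12 * -m by ring, zpow_add₀ (denom_ne_zero _ z)]
  ring

lemma mdifferentiable_mul_discriminant_zpow {f : UpperHalfPlane → ℂ}
    (hf : MDifferentiable 𝓘(ℂ) 𝓘(ℂ) f) (m : ℤ) :
    MDifferentiable 𝓘(ℂ) 𝓘(ℂ) (fun τ ↦ f τ * ModularForm.discriminant τ ^ m) := by
  have hd := CuspForm.discriminant.holo'
  rw [UpperHalfPlane.mdifferentiable_iff] at hf hd ⊢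
  exact hf.mul (hd.zpow (Or.inl fun z _ ↦ ModularForm.discriminant_ne_zero _))

lemma HasExpansion.isBoundedAtImInfty_mul_discriminant_zpow {f : UpperHalfPlane → ℂ} {c : ℤ → ℂ}
    (h : HasExpansion f c) {m : ℤ} (hm : ∀ n < m, c n = 0) :
    IsBoundedAtImInfty (fun τ ↦ f τ * ModularForm.discriminant τ ^ (-m)) := by
  have hP := (ModularForm.tendsto_atImInfty_tprod_one_sub_eta_q_pow.zpow₀ (-m)
    (Or.inl one_ne_zero)).isBigO_one ℝ
  have := (h.isBoundedAtImInfty_mul_qexp_zpow hm).mul hP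
  refine (this.congr_left fun τ ↦ ?_).trans (by simpa using Asymptotics.isBigO_refl _ _)
  rw [ModularForm.discriminant_eq_q_prod, mul_zpow, ← mul_assoc]
  simp [qexp, Function.Periodic.qParam]

/-- Dividing a form vanishing to order `m` at infinity by `Δ ^ m` gives a modular form. -/
def WhmForm.divDiscriminantZPow {k : ℤ} (f : WhmForm ⊤ k) {m : ℤ}
    (hm : ∀ n < m, f.coeff n = 0) : ModularForm 𝒮ℒ (k - 12 * m) where
  toFun τ := f.toFun τ * ModularForm.discriminant τ ^ (-m)
  slash_action_eq' := fun _ ⟨γ, hγ⟩ ↦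
    hγ ▸ slash_mul_discriminant_zpow (f.slash_eq γ (Subgroup.mem_top γ)) m
  holo' := mdifferentiable_mul_discriminant_zpow f.holo _
  bdd_at_cusps' {c} hc := by
    rw [Subgroup.IsArithmetic.isCusp_iff_isCusp_SL2Z] at hc
    rw [OnePoint.isBoundedAt_iff_forall_SL2Z hc]
    intro γ _
    rw [slash_mul_discriminant_zpow (f.slash_eq γ (Subgroup.mem_top γ)) m]
    exact f.expansion.isBoundedAtImInfty_mul_discriminant_zpow hm

/-- There are no nonzero level one modular forms of negative weight or of weight two. -/
lemma ModularForm.levelOne_eq_zero_of_neg_or_eq_two {w : ℤ} (hw : w < 0 ∨ w = 2)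
    (g : ModularForm 𝒮ℒ w) : g = 0 := by
  rcases hw with hw | rfl
  · exact rank_zero_iff_forall_zero.mp (ModularForm.levelOne_neg_weight_rank_zero hw) g
  · exact rank_zero_iff_forall_zero.mp ModularForm.levelOne_weight_two_rank_zero g

/-- Every nonzero weakly holomorphic modular form of weight `k = 12ℓ + k'` on `SL₂(ℤ)`
has `ord_∞ f ≤ ℓ`, i.e. some nonzero coefficient with index `≤ ℓ`. -/
theorem stmt_2 (k ℓ k' : ℤ) (hk : Even k) (hk' : k' ∈ ({0, 4, 6, 8, 10, 14} : Set ℤ))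
    (hdecomp : k = 12 * ℓ + k') (f : WhmForm ⊤ k) (hf : f.toFun ≠ 0) :
    ∃ n : ℤ, n ≤ ℓ ∧ f.coeff n ≠ 0 := by
  by_contra! h
  have hm : ∀ n < ℓ + 1, f.coeff n = 0 := fun n hn ↦ h n (by lia)
  have hw : k - 12 * (ℓ + 1) < 0 ∨ k - 12 * (ℓ + 1) = 2 := by
    simp only [Set.mem_insert_iff, Set.mem_singleton_iff] at hk'
    lia
  refine hf (funext fun τ ↦ ?_)
  have hg : f.toFun τ * ModularForm.discriminant τ ^ (-(ℓ + 1)) = 0 :=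
    DFunLike.congr_fun
      (ModularForm.levelOne_eq_zero_of_neg_or_eq_two hw (f.divDiscriminantZPow hm)) τ
  exact (mul_eq_zero.mp hg).resolve_right (zpow_ne_zero _ (ModularForm.discriminant_ne_zero τ))
end
end

section
/- The basis elements f_{k,m} have the form f_{k,m} = Δ^ℓ E_{k'} F_{k,D}(j), where F_{k,D}(x) is a monic polynomial of degree D = ℓ + m with integer coefficients. In particular all Fourier coefficients a_k(m,n) of f_{k,m} are integers. -/
open UpperHalfPlane Complex CongruenceSubgroup MatrixGroups
open scoped ModularForm Real MatrixGroups Manifold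

noncomputable section

/-- `f τ = q ^ a * ∑ p n q ^ n` for every `τ`, where `n` runs over the natural numbers. -/
def HasQSeries (a : ℤ) (p : PowerSeries ℂ) (f : UpperHalfPlane → ℂ) : Prop :=
  ∀ τ : UpperHalfPlane, HasSum (fun n : ℕ => p.coeff n * qexp τ ^ n) (qexp τ ^ (-a) * f τ)

lemma qexp_eq_qParam (τ : UpperHalfPlane) : qexp τ = Function.Periodic.qParam 1 τ := by
  simp [qexp, Function.Periodic.qParam]

namespace HasQSeries

variable {a b : ℤ} {p r : PowerSeries ℂ} {f g : UpperHalfPlane → ℂ}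

lemma add (hf : HasQSeries a p f) (hg : HasQSeries a r g) : HasQSeries a (p + r) (f + g) := by
  intro τ
  simpa [add_mul, mul_add] using (hf τ).add (hg τ)

lemma const_mul (c : ℂ) (hf : HasQSeries a p f) :
    HasQSeries a (PowerSeries.C c * p) (fun τ => c * f τ) := by
  intro τ
  simpa [mul_assoc, mul_left_comm] using (hf τ).mul_left c

lemma sub (hf : HasQSeries a p f) (hg : HasQSeries a r g) : HasQSeries a (p - r) (f - g) := by
  intro τ
  simpa [sub_mul, mul_sub] using (hf τ).sub (hg τ)

lemma mul (hf : HasQSeries a p f) (hg : HasQSeries b r g) :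
    HasQSeries (a + b) (p * r) (f * g) := by
  intro τ
  have h := summable_norm_sum_mul_antidiagonal_of_summable_norm (hf τ).summable.norm
    (hg τ).summable.norm
  have h2 := tsum_mul_tsum_eq_tsum_sum_antidiagonal_of_summable_norm (hf τ).summable.norm
    (hg τ).summable.norm
  rw [(hf τ).tsum_eq, (hg τ).tsum_eq] at h2
  have h3 := h.of_norm.hasSum
  rw [← h2] at h3
  convert! h3 using 1
  · funext n
    rw [PowerSeries.coeff_mul, Finset.sum_mul]
    refine Finset.sum_congr rfl fun x hx => ?_
    rw [← Finset.HasAntidiagonal.mem_antidiagonal.mp hx, pow_add]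
    ring
  · rw [Pi.mul_apply, neg_add, zpow_add₀ (qexp_ne_zero τ)]
    ring

lemma one : HasQSeries 0 1 (1 : UpperHalfPlane → ℂ) := by
  intro τ
  have := hasSum_ite_eq (0 : ℕ) (1 : ℂ)
  convert! this using 1
  · funext n
    rw [PowerSeries.coeff_one]
    split_ifs with h <;> simp [h]
  · simp

lemma pow (hf : HasQSeries a p f) (n : ℕ) : HasQSeries (n * a) (p ^ n) (f ^ n) := by
  induction n with
  | zero => simpa using one
  | succ n ih =>
    rw [pow_succ, pow_succ]
    convert! ih.mul hf using 1
    push_cast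
    ring

lemma shift (n : ℕ) : HasQSeries a (PowerSeries.X ^ n * p) f ↔ HasQSeries (a + n) p f := by
  refine forall_congr' fun τ => ?_
  have hq := qexp_ne_zero τ
  rw [← hasSum_nat_add_iff' n, Finset.sum_eq_zero, sub_zero,
    ← hasSum_mul_left_iff (zpow_ne_zero (-n : ℤ) hq)]
  · refine iff_of_eq (congrArg₂ (HasSum · · _) (funext fun i => ?_) ?_)
    · rw [PowerSeries.coeff_X_pow_mul, pow_add, zpow_neg, zpow_natCast]
      field_simp
    · rw [← mul_assoc, ← zpow_add₀ hq, neg_add_rev]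
  · intro i hi
    rw [PowerSeries.coeff_X_pow_mul', if_neg (by simpa using hi), zero_mul]

lemma eq_zero (hf : HasQSeries a p 0) : p = 0 := by
  ext n
  have := ModularFormClass.qExpansion_coeff_unique (c := fun n => p.coeff n) (Γ := 𝒮ℒ) (k := 0)
    one_pos one_mem_strictPeriods_SL (f := (0 : ModularForm 𝒮ℒ 0))
    (fun τ => by simpa [qexp_eq_qParam] using hf τ) n
  simpa [UpperHalfPlane.qExpansion_zero] using this

lemma unique (hf : HasQSeries a p f) (hg : HasQSeries a r f) : p = r :=
  sub_eq_zero.mp (eq_zero (a := a) (by simpa using hf.sub hg))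

lemma isBoundedAtImInfty (hf : HasQSeries 0 p f) : IsBoundedAtImInfty f :=
  UpperHalfPlane.isBoundedAtImInfty_of_hasSum_qExpansion (h := 1) one_pos
    (fun τ => by simpa [qexp_eq_qParam] using hf τ)

lemma qExpansion_eq {k : ℤ} {f : ModularForm 𝒮ℒ k} (hf : HasQSeries 0 p f) :
    qExpansion 1 f = p := by
  ext n
  exact (ModularFormClass.qExpansion_coeff_unique (c := fun n => p.coeff n)
    one_pos one_mem_strictPeriods_SL
    (fun τ => by simpa [qexp_eq_qParam] using hf τ) n).symm

end HasQSeries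

lemma ModularForm.hasQSeries_qExpansion {k : ℤ} (f : ModularForm 𝒮ℒ k) :
    HasQSeries 0 (qExpansion 1 f) f := fun τ => by
  simpa [qexp_eq_qParam] using UpperHalfPlane.hasSum_qExpansion one_pos
    (SlashInvariantFormClass.periodic_comp_ofComplex f one_mem_strictPeriods_SL)
    (ModularFormClass.holo f) (ModularFormClass.bdd_at_infty f) τ

lemma WhmForm.hasQSeries {Γ : Subgroup SL(2, ℤ)} {k : ℤ} (f : WhmForm Γ k) (a : ℤ)
    (ha : ∀ n < a, f.coeff n = 0) :
    HasQSeries a (.mk fun n => f.coeff (n + a)) f.toFun := by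
  intro τ
  have h := (f.expansion.2 τ).mul_left (qexp τ ^ (-a))
  have hinj : Function.Injective (fun n : ℕ => (n : ℤ) + a) := fun x y h => by simpa using h
  rw [← hinj.hasSum_iff] at h
  · convert! h using 1
    funext n
    simp only [PowerSeries.coeff_mk, Function.comp]
    rw [mul_left_comm, ← zpow_add₀ (qexp_ne_zero τ)]
    simp
  · intro n hn
    rw [ha n, zero_mul, mul_zero]
    by_contra! hna
    exact hn ⟨(n - a).toNat, by simp; lia⟩

/-- The modular form attached to a function with a `q`-series without negative powers. -/
def modularFormOfHasQSeries {k : ℤ} {p : PowerSeries ℂ} (f : UpperHalfPlane → ℂ)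
    (hol : MDifferentiable 𝓘(ℂ) 𝓘(ℂ) f) (hs : ∀ γ : SL(2, ℤ), f ∣[k] γ = f)
    (hf : HasQSeries 0 p f) : ModularForm 𝒮ℒ k where
  toFun := f
  slash_action_eq' := fun _ ⟨γ, hγ⟩ => hγ ▸ hs γ
  holo' := hol
  bdd_at_cusps' {c} hc := by
    rw [OnePoint.isBoundedAt_iff_forall_SL2Z hc]
    intro γ _
    rw [hs γ]
    exact hf.isBoundedAtImInfty

@[simp]
lemma coe_modularFormOfHasQSeries {k : ℤ} {p : PowerSeries ℂ} (f : UpperHalfPlane → ℂ)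
    (hol : MDifferentiable 𝓘(ℂ) 𝓘(ℂ) f) (hs : ∀ γ : SL(2, ℤ), f ∣[k] γ = f)
    (hf : HasQSeries 0 p f) : ⇑(modularFormOfHasQSeries f hol hs hf) = f := rfl

lemma discriminant_slash (γ : SL(2, ℤ)) :
    ModularForm.discriminant ∣[(12 : ℤ)] γ = ModularForm.discriminant :=
  CuspForm.discriminant.slash_action_eq' _ ⟨γ, rfl⟩

lemma ModularForm.eq_zero_of_coeff_zero_eq_zero {k : ℤ} (hk : k < 12 ∨ k = 14)
    (f : ModularForm 𝒮ℒ k) (h0 : (qExpansion 1 f).coeff 0 = 0) : f = 0 := by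
  suffices CuspForm.discriminantEquiv (toCuspForm f h0) = 0 by
    simpa [CuspForm.discriminantEquiv.map_eq_zero_iff, DFunLike.ext_iff]
  rcases hk with hk | rfl
  · exact rank_zero_iff_forall_zero.mp (levelOne_neg_weight_rank_zero (by lia)) _
  · exact rank_zero_iff_forall_zero.mp levelOne_weight_two_rank_zero _

lemma discriminant_inv_hasQSeries :
    ∃ p, HasQSeries (-1) p (fun τ => (ModularForm.discriminant τ)⁻¹) := by
  set f : UpperHalfPlane → ℂ := fun τ =>
    Function.Periodic.qParam 1 τ / ModularForm.discriminant τ with hf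
  have hper : Function.Periodic (f ∘ ofComplex) (1 : ℝ) := by
    intro w
    have h1 : ModularForm.discriminant (ofComplex (w + (1 : ℝ))) =
        ModularForm.discriminant (ofComplex w) :=
      SlashInvariantFormClass.periodic_comp_ofComplex (h := 1) CuspForm.discriminant
        one_mem_strictPeriods_SL w
    have h2 : Function.Periodic.qParam 1 (ofComplex (w + (1 : ℝ))) =
        Function.Periodic.qParam 1 (ofComplex w) := by
      by_cases hw : 0 < w.im
      · rw [ofComplex_apply_of_im_pos hw, ofComplex_apply_of_im_pos (by simpa using hw)]
        simpa [Function.Periodic.qParam, mul_add] using Complex.exp_periodic (2 * π * Complex.I * w)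
      · rw [ofComplex_apply_of_im_nonpos (by simpa using hw),
          ofComplex_apply_of_im_nonpos (by simpa using hw)]
    simp only [Function.comp, hf]
    rw [h1, h2]
  have hq : MDifferentiable 𝓘(ℂ) 𝓘(ℂ)
      (fun τ : UpperHalfPlane => Function.Periodic.qParam 1 τ) := by
    rw [UpperHalfPlane.mdifferentiable_iff]
    refine DifferentiableOn.congr (f := Function.Periodic.qParam 1)
      (Function.Periodic.differentiable_qParam).differentiableOn fun z hz => ?_
    simp [ofComplex_apply_of_im_pos hz]
  have hhol : MDifferentiable 𝓘(ℂ) 𝓘(ℂ) f :=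
    hq.div CuspForm.discriminant.holo' ModularForm.discriminant_ne_zero
  have hbdd : IsBoundedAtImInfty f := by
    rw [IsBoundedAtImInfty, Filter.BoundedAtFilter]
    refine (Asymptotics.div_isBoundedUnder_of_isBigO ?_).isBigO_one ℝ
    refine Asymptotics.IsBigO.trans (.of_bound 1 (.of_forall fun τ => ?_))
      ModularForm.exp_isBigO_discriminant
    simp [Function.Periodic.norm_qParam]
  refine ⟨qExpansion 1 f, fun τ => ?_⟩
  simpa [qexp_eq_qParam, hf, div_eq_mul_inv] using
    UpperHalfPlane.hasSum_qExpansion one_pos hper hhol hbdd τ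

section IntegralExpansions

open ModularForm (E₄ E₆)
open EisensteinSeries (E_qExpansion_coeff)

/-- Base change of formal power series from `ℤ` to `ℂ`. -/
abbrev intSeries : PowerSeries ℤ →+* PowerSeries ℂ := PowerSeries.map (Int.castRingHom ℂ)

lemma constantCoeff_intSeries (p : PowerSeries ℤ) :
    PowerSeries.constantCoeff (intSeries p) = ((PowerSeries.constantCoeff p : ℤ) : ℂ) := by
  rw [← PowerSeries.coeff_zero_eq_constantCoeff_apply, PowerSeries.coeff_map]
  simp

/-- The generating series of the divisor power sum `σ k`. -/
def sigmaSeries (k : ℕ) : PowerSeries ℤ := .mk fun n => (ArithmeticFunction.sigma k n : ℤ)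

lemma qExpansion_E₄ :
    qExpansion 1 E₄ = intSeries (1 + PowerSeries.C 240 * sigmaSeries 3) := by
  ext n
  rw [E_qExpansion_coeff _ ⟨2, rfl⟩, PowerSeries.coeff_map, map_add, PowerSeries.coeff_C_mul]
  rcases eq_or_ne n 0 with rfl | hn
  · simp [sigmaSeries]
  · norm_num [hn, PowerSeries.coeff_one, sigmaSeries,
      show bernoulli 4 = -1 / 30 by decide +kernel]

lemma qExpansion_E₆ :
    qExpansion 1 E₆ = intSeries (1 - PowerSeries.C 504 * sigmaSeries 5) := by
  ext n
  rw [E_qExpansion_coeff _ ⟨3, rfl⟩, PowerSeries.coeff_map, map_sub, PowerSeries.coeff_C_mul]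
  rcases eq_or_ne n 0 with rfl | hn
  · simp [sigmaSeries]
  · norm_num [hn, PowerSeries.coeff_one, sigmaSeries,
      show bernoulli 6 = 1 / 42 by decide +kernel]

lemma twelve_dvd_sigma (n : ℕ) :
    (12 : ℤ) ∣ 5 * (ArithmeticFunction.sigma 3 n : ℤ) + 7 * ArithmeticFunction.sigma 5 n := by
  simp only [ArithmeticFunction.sigma_apply, Nat.cast_sum, Finset.mul_sum,
    ← Finset.sum_add_distrib]
  refine Finset.dvd_sum fun d _ => (ZMod.intCast_zmod_eq_zero_iff_dvd _ 12).mp ?_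
  push_cast
  generalize (d : ZMod 12) = x
  revert x
  decide

lemma twelve_dvd_sigmaSeries :
    ∃ c, PowerSeries.C 5 * sigmaSeries 3 + PowerSeries.C 7 * sigmaSeries 5 =
      PowerSeries.C 12 * c := by
  choose c hc using twelve_dvd_sigma
  refine ⟨.mk c, ?_⟩
  ext n
  simp only [map_add, PowerSeries.coeff_C_mul, sigmaSeries, PowerSeries.coeff_mk]
  exact hc n

lemma hasQSeries_discriminant :
    HasQSeries 0 (qExpansion 1 ModularForm.discriminant) ModularForm.discriminant :=
  (CuspForm.toModularFormₗ CuspForm.discriminant).hasQSeries_qExpansion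

lemma qExpansion_discriminant_mem_range :
    ∃ δ : PowerSeries ℤ, qExpansion 1 ModularForm.discriminant = intSeries δ := by
  obtain ⟨c, hc⟩ := twelve_dvd_sigmaSeries
  have h4 := (ModularForm.hasQSeries_qExpansion E₄).pow 3
  have h6 := (ModularForm.hasQSeries_qExpansion E₆).pow 2
  simp only [mul_zero] at h4 h6
  have hfun : (⇑E₄ ^ 3 - ⇑E₆ ^ 2 : UpperHalfPlane → ℂ) =
      fun τ => 1728 * ModularForm.discriminant τ := by
    funext τ
    rw [ModularForm.discriminant_eq_E₄_cube_sub_E₆_sq]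
    simp [mul_div_cancel₀]
  have h := h4.sub h6
  rw [hfun] at h
  have h := h.unique (hasQSeries_discriminant.const_mul 1728)
  refine ⟨c + 100 * sigmaSeries 3 ^ 2 + 8000 * sigmaSeries 3 ^ 3 - 147 * sigmaSeries 5 ^ 2, ?_⟩
  have h0 : (1728 : PowerSeries ℂ) ≠ 0 := by
    rw [← map_ofNat PowerSeries.C, map_ne_zero_iff _ PowerSeries.C_injective]
    norm_num
  refine mul_left_cancel₀ h0 ?_
  simp only [map_ofNat] at h hc
  rw [← h, qExpansion_E₄, qExpansion_E₆, ← map_pow, ← map_pow, ← map_sub,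
    ← map_ofNat intSeries, ← map_mul]
  congr 1
  simp only [map_ofNat]
  linear_combination 144 * hc

/-- The discriminant and its integer powers have integral `q`-series. -/
lemma exists_hasQSeries_discriminant_zpow :
    ∃ u : (PowerSeries ℤ)ˣ,
      (∀ n : ℤ, PowerSeries.constantCoeff (↑(u ^ n) : PowerSeries ℤ) = 1) ∧
      ∀ n : ℤ, HasQSeries n (intSeries ↑(u ^ n)) (fun τ => ModularForm.discriminant τ ^ n) := by
  obtain ⟨δ, hδ⟩ := qExpansion_discriminant_mem_range
  have h0 : (qExpansion 1 ModularForm.discriminant).coeff 0 = 0 :=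
    CuspFormClass.qExpansion_coeff_zero CuspForm.discriminant one_pos one_mem_strictPeriods_SL
  have h1 := ModularForm.discriminant_qExpansion_coeff_one
  rw [hδ, PowerSeries.coeff_map] at h0 h1
  have h0 : δ.coeff 0 = 0 := by simpa using h0
  have h1 : δ.coeff 1 = 1 := by simpa using h1
  obtain ⟨v, rfl⟩ := PowerSeries.X_dvd_iff.mpr (by simpa using h0)
  have hv : PowerSeries.constantCoeff v = 1 := by
    simpa using h1
  have hΔ : HasQSeries 1 (intSeries v) ModularForm.discriminant := by
    have := hasQSeries_discriminant
    rw [hδ, map_mul, PowerSeries.map_X, ← pow_one PowerSeries.X, HasQSeries.shift] at this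
    simpa using this
  obtain ⟨u, rfl⟩ : IsUnit v := PowerSeries.isUnit_iff_constantCoeff.mpr (by simp [hv])
  have hΔi : HasQSeries (-1) (intSeries ↑(u⁻¹)) (fun τ => (ModularForm.discriminant τ)⁻¹) := by
    obtain ⟨p, hp⟩ := discriminant_inv_hasQSeries
    have h := hp.mul hΔ
    have hone : ((fun τ => (ModularForm.discriminant τ)⁻¹) * ModularForm.discriminant :
        UpperHalfPlane → ℂ) = 1 := by
      funext τ
      simp [ModularForm.discriminant_ne_zero]
    rw [hone, neg_add_cancel] at h
    have h := h.unique HasQSeries.one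
    convert! hp
    rw [← mul_one (intSeries _), ← h, mul_left_comm, ← map_mul]
    simp
  refine ⟨u, fun n => ?_, fun n => ?_⟩
  · have hu : Units.map (PowerSeries.constantCoeff (R := ℤ)).toMonoidHom u = 1 := Units.ext hv
    have := congrArg Units.val
      (map_zpow (Units.map (PowerSeries.constantCoeff (R := ℤ)).toMonoidHom) u n)
    rw [hu, one_zpow] at this
    exact this
  obtain ⟨n, rfl | rfl⟩ := n.eq_nat_or_neg
  · convert! hΔ.pow n using 1
    · simp
    · simp
  · convert! hΔi.pow n using 1
    · simp
    · simp [← inv_pow]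
    · funext τ
      simp

lemma exists_modularForm_hasQSeries_add {k l : ℤ}
    (hk : ∃ (g : ModularForm 𝒮ℒ k) (e : PowerSeries ℤ), PowerSeries.constantCoeff e = 1 ∧
      HasQSeries 0 (intSeries e) g)
    (hl : ∃ (g : ModularForm 𝒮ℒ l) (e : PowerSeries ℤ), PowerSeries.constantCoeff e = 1 ∧
      HasQSeries 0 (intSeries e) g) :
    ∃ (g : ModularForm 𝒮ℒ (k + l)) (e : PowerSeries ℤ), PowerSeries.constantCoeff e = 1 ∧
      HasQSeries 0 (intSeries e) g := by
  obtain ⟨g, e, he, hg⟩ := hk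
  obtain ⟨g', e', he', hg'⟩ := hl
  refine ⟨g.mul g', e * e', by simp [he, he'], ?_⟩
  simpa using hg.mul hg'

lemma exists_modularForm_hasQSeries {k : ℤ} (hk : k ∈ ({0, 4, 6, 8, 10, 12, 14} : Set ℤ)) :
    ∃ (g : ModularForm 𝒮ℒ k) (e : PowerSeries ℤ), PowerSeries.constantCoeff e = 1 ∧
      HasQSeries 0 (intSeries e) g := by
  have h0 : ∃ (g : ModularForm 𝒮ℒ 0) (e : PowerSeries ℤ), PowerSeries.constantCoeff e = 1 ∧
      HasQSeries 0 (intSeries e) g := ⟨1, 1, by simp, by simpa using HasQSeries.one⟩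
  have h4 : ∃ (g : ModularForm 𝒮ℒ 4) (e : PowerSeries ℤ), PowerSeries.constantCoeff e = 1 ∧
      HasQSeries 0 (intSeries e) g :=
    ⟨_, _, by simp [sigmaSeries], qExpansion_E₄ ▸ ModularForm.hasQSeries_qExpansion _⟩
  have h6 : ∃ (g : ModularForm 𝒮ℒ 6) (e : PowerSeries ℤ), PowerSeries.constantCoeff e = 1 ∧
      HasQSeries 0 (intSeries e) g :=
    ⟨_, _, by simp [sigmaSeries], qExpansion_E₆ ▸ ModularForm.hasQSeries_qExpansion _⟩
  have h8 := exists_modularForm_hasQSeries_add h4 h4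
  simp only [Set.mem_insert_iff, Set.mem_singleton_iff] at hk
  rcases hk with rfl | rfl | rfl | rfl | rfl | rfl | rfl
  · exact h0
  · exact h4
  · exact h6
  · exact h8
  · exact exists_modularForm_hasQSeries_add h4 h6
  · exact exists_modularForm_hasQSeries_add h4 h8
  · exact exists_modularForm_hasQSeries_add h6 h8

lemma exists_eq_add_smul_discriminant (f g : ModularForm 𝒮ℒ 12)
    (h : (qExpansion 1 f).coeff 0 = (qExpansion 1 g).coeff 0) :
    ∃ c : ℂ, ∀ τ, f τ = g τ + c * ModularForm.discriminant τ := by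
  have h0 : (qExpansion 1 (f - g)).coeff 0 = 0 := by
    rw [ModularForm.qExpansion_sub one_pos one_mem_strictPeriods_SL, map_sub,
      h, sub_self]
  obtain ⟨c, hc⟩ := CuspForm.exists_smul_discriminant_of_weight_eq_twelve
    (ModularForm.toCuspForm (f - g) h0)
  refine ⟨c, fun τ => ?_⟩
  have := DFunLike.congr_fun hc τ
  simp at this
  rw [this]
  ring

end IntegralExpansions

namespace WhmForm

lemma eq_discriminant (Δ : WhmForm ⊤ 12) (hΔ : IsBasisElt 12 1 (-1) Δ) :
    Δ.toFun = ModularForm.discriminant := by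
  have hn : ∀ n < 1, Δ.coeff n = 0 := fun n hn => hΔ.2 n (by lia) (by lia)
  have hq := Δ.hasQSeries 0 fun n h => hn n (by lia)
  obtain ⟨c, hc⟩ := exists_eq_add_smul_discriminant
    (modularFormOfHasQSeries Δ.toFun Δ.holo (fun γ => Δ.slash_eq γ trivial) hq) 0 (by
      rw [HasQSeries.qExpansion_eq hq]
      simp [hn, UpperHalfPlane.qExpansion_zero])
  have hfun : Δ.toFun = fun τ => c * ModularForm.discriminant τ := by
    funext τ
    simpa using hc τ
  have h := hq.unique (hfun ▸ hasQSeries_discriminant.const_mul c)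
  have h1 := congrArg (PowerSeries.coeff 1) h
  have hΔ1 : Δ.coeff 1 = 1 := hΔ.1
  have hc1 : c = 1 := by
    simpa [ModularForm.discriminant_qExpansion_coeff_one, hΔ1, eq_comm] using h1
  simpa [hc1] using hfun

lemma exists_hasQSeries_eisenstein {k' : ℤ} (hk' : k' ∈ ({0, 4, 6, 8, 10, 14} : Set ℤ))
    (E : WhmForm ⊤ k') (hE : IsBasisElt k' 0 0 E) :
    ∃ e : PowerSeries ℤ, PowerSeries.constantCoeff e = 1 ∧
      HasQSeries 0 (intSeries e) E.toFun := by
  simp only [Set.mem_insert_iff, Set.mem_singleton_iff] at hk'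
  obtain ⟨g, e, he, hg⟩ := exists_modularForm_hasQSeries (k := k') (by
    simp only [Set.mem_insert_iff, Set.mem_singleton_iff]; lia)
  refine ⟨e, he, ?_⟩
  have hq := E.hasQSeries 0 fun n hn => hE.2 n (by lia) (by lia)
  set h := modularFormOfHasQSeries E.toFun E.holo (fun γ => E.slash_eq γ trivial) hq
  have h0 : h - g = 0 := ModularForm.eq_zero_of_coeff_zero_eq_zero (by lia) _ (by
    rw [FunLike.coe_sub, ModularForm.qExpansion_sub one_pos one_mem_strictPeriods_SL,
      HasQSeries.qExpansion_eq hq, HasQSeries.qExpansion_eq hg]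
    have := hE.1
    simp_all [constantCoeff_intSeries])
  have : E.toFun = g := congrArg DFunLike.coe (sub_eq_zero.mp h0)
  rwa [this]

lemma exists_hasQSeries_jInvariant (J : WhmForm ⊤ 0) (hJ1 : J.coeff (-1) = 1)
    (hJ0 : J.coeff 0 = 744) (hJneg : ∀ n : ℤ, n < -1 → J.coeff n = 0) :
    ∃ j : PowerSeries ℤ, PowerSeries.constantCoeff j = 1 ∧
      HasQSeries (-1) (intSeries j) J.toFun := by
  obtain ⟨u, hu, hΔ⟩ := exists_hasQSeries_discriminant_zpow
  obtain ⟨g, e, he, hg⟩ := exists_modularForm_hasQSeries (k := 12) (by simp)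
  have hu1 : PowerSeries.constantCoeff (u : PowerSeries ℤ) = 1 := by simpa using hu 1
  have hΔ1 : HasQSeries 1 (intSeries u) ModularForm.discriminant := by simpa using hΔ 1
  have hJ := J.hasQSeries (-1) hJneg
  have hJΔ := hJ.mul hΔ1
  rw [neg_add_cancel] at hJΔ
  have hslash (γ : SL(2, ℤ)) :
      (J.toFun * ModularForm.discriminant) ∣[(12 : ℤ)] γ =
        J.toFun * ModularForm.discriminant := by
    have := ModularForm.mul_slash_SL2 0 12 γ J.toFun ModularForm.discriminant
    rw [zero_add] at this
    rw [this, J.slash_eq γ trivial, discriminant_slash]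
  obtain ⟨c, hc⟩ := exists_eq_add_smul_discriminant
    (modularFormOfHasQSeries _ (J.holo.mul CuspForm.discriminant.holo') hslash hJΔ) g (by
      rw [HasQSeries.qExpansion_eq hJΔ, HasQSeries.qExpansion_eq hg]
      simp [constantCoeff_intSeries, hu1, he, hJ1])
  have hfun : J.toFun * ModularForm.discriminant =
      ⇑g + fun τ => c * ModularForm.discriminant τ := funext hc
  have hcΔ : HasQSeries 0 (PowerSeries.X ^ 1 * (PowerSeries.C c * intSeries u))
      (fun τ => c * ModularForm.discriminant τ) :=
    (HasQSeries.shift 1).mpr (by simpa using hΔ1.const_mul c)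
  have hsum := hg.add hcΔ
  rw [← hfun] at hsum
  obtain ⟨z, rfl⟩ : ∃ z : ℤ, c = z := by
    have h1 := congrArg (PowerSeries.coeff 1) (hJΔ.unique hsum)
    refine ⟨744 + u.1.coeff 1 - e.coeff 1, ?_⟩
    simp [PowerSeries.coeff_mul, Finset.Nat.antidiagonal_succ, hJ0, hJ1, hu1,
      PowerSeries.coeff_X] at h1
    push_cast
    linear_combination - h1
  refine ⟨(e + PowerSeries.X * (PowerSeries.C z * (u : PowerSeries ℤ))) *
    ((u ^ (-1 : ℤ) : (PowerSeries ℤ)ˣ) : PowerSeries ℤ),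
    ?_, ?_⟩
  · rw [map_mul, hu]
    simp [he]
  · have h := hsum.mul (hΔ (-1))
    convert! h using 1
    · simp
    · funext τ
      simp [ModularForm.discriminant_ne_zero]

end WhmForm

lemma exists_polynomial_sum_congr {R : Type*} [CommRing R] {j : PowerSeries R}
    (hj : PowerSeries.constantCoeff j = 1) (d : ℕ) (w : PowerSeries R) :
    ∃ F : Polynomial R, F.natDegree ≤ d ∧ F.coeff d = PowerSeries.constantCoeff w ∧
      PowerSeries.X ^ (d + 1) ∣ ∑ i ∈ Finset.range (d + 1),
        PowerSeries.C (F.coeff i) * (PowerSeries.X ^ (d - i) * j ^ i) - w := by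
  induction d generalizing w with
  | zero =>
    refine ⟨.C (PowerSeries.constantCoeff w), by simp, by simp, ?_⟩
    simp [PowerSeries.X_dvd_iff]
  | succ d ih =>
    obtain ⟨v, hv⟩ := PowerSeries.X_dvd_iff (φ := w - PowerSeries.C (PowerSeries.constantCoeff w) *
      j ^ (d + 1)).mpr (by simp [hj])
    obtain ⟨F, hdeg, -, r, hr⟩ := ih v
    have hlead : F.coeff (d + 1) = 0 := Polynomial.coeff_eq_zero_of_natDegree_lt (by lia)
    refine ⟨.C (PowerSeries.constantCoeff w) * .X ^ (d + 1) + F, ?_, by simp [hlead], r, ?_⟩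
    · exact Polynomial.natDegree_add_le_of_degree_le (Polynomial.natDegree_C_mul_X_pow_le _ _)
        (by lia)
    · have hsum : ∑ i ∈ Finset.range (d + 1), PowerSeries.C
          ((.C (PowerSeries.constantCoeff w) * .X ^ (d + 1) + F : Polynomial R).coeff i) *
            (PowerSeries.X ^ (d + 1 - i) * j ^ i) =
          PowerSeries.X * ∑ i ∈ Finset.range (d + 1),
            PowerSeries.C (F.coeff i) * (PowerSeries.X ^ (d - i) * j ^ i) := by
        rw [Finset.mul_sum]
        refine Finset.sum_congr rfl fun i hi => ?_
        have hi : i < d + 1 := Finset.mem_range.mp hi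
        rw [Polynomial.coeff_add, Polynomial.coeff_C_mul_X_pow, if_neg hi.ne, zero_add,
          Nat.sub_add_comm (by lia), pow_succ]
        ring
      rw [Finset.sum_range_succ, hsum, Polynomial.coeff_add, Polynomial.coeff_C_mul_X_pow,
        if_pos rfl, hlead, add_zero, Nat.sub_self]
      linear_combination PowerSeries.X * hr - hv

namespace HasQSeries

lemma sum {ι : Type*} (s : Finset ι) {a : ℤ} {p : ι → PowerSeries ℂ}
    {f : ι → UpperHalfPlane → ℂ} (h : ∀ i ∈ s, HasQSeries a (p i) (f i)) :
    HasQSeries a (∑ i ∈ s, p i) (fun τ => ∑ i ∈ s, f i τ) := by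
  intro τ
  simpa [Finset.sum_mul, Finset.mul_sum] using hasSum_sum fun i hi => h i hi τ

lemma polynomial_eval {f : UpperHalfPlane → ℂ} {j : PowerSeries ℤ}
    (hf : HasQSeries (-1) (intSeries j) f) {d : ℕ} {F : Polynomial ℤ} (hF : F.natDegree ≤ d) :
    HasQSeries (-d) (intSeries (∑ i ∈ Finset.range (d + 1),
        PowerSeries.C (F.coeff i) * (PowerSeries.X ^ (d - i) * j ^ i)))
      (fun τ => (F.map (Int.castRingHom ℂ)).eval (f τ)) := by
  have heval : (fun τ => (F.map (Int.castRingHom ℂ)).eval (f τ)) =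
      fun τ => ∑ i ∈ Finset.range (d + 1), (F.coeff i : ℂ) * (f ^ i) τ := by
    funext τ
    rw [Polynomial.eval_eq_sum_range' (n := d + 1)
      (Nat.lt_succ_of_le (Polynomial.natDegree_map_le.trans hF))]
    simp
  rw [heval, map_sum]
  refine sum _ fun i hi => ?_
  have hi : i < d + 1 := Finset.mem_range.mp hi
  rw [map_mul, map_mul, PowerSeries.map_C, map_pow, map_pow, PowerSeries.map_X]
  refine const_mul _ ((shift _).mpr ?_)
  convert! hf.pow i using 1
  push_cast [Nat.lt_succ_iff.mp hi]
  ring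

end HasQSeries

lemma slash_eq_self_iff {k : ℤ} {f : UpperHalfPlane → ℂ} {γ : SL(2, ℤ)} :
    f ∣[k] γ = f ↔ ∀ τ, f (γ • τ) = denom γ τ ^ k * f τ := by
  rw [funext_iff]
  refine forall_congr' fun τ => ?_
  rw [ModularForm.SL_slash_apply, zpow_neg, ← div_eq_mul_inv,
    div_eq_iff (zpow_ne_zero _ (denom_ne_zero _ _)), mul_comm]

lemma eq_zero_of_hasQSeries_of_slash_eq {k : ℤ} (hk : k < 0 ∨ k = 2) {p : PowerSeries ℂ}
    {f : UpperHalfPlane → ℂ} (hol : MDifferentiable 𝓘(ℂ) 𝓘(ℂ) f)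
    (hs : ∀ γ : SL(2, ℤ), f ∣[k] γ = f) (hf : HasQSeries 0 p f) : f = 0 := by
  have : modularFormOfHasQSeries f hol hs hf = 0 := by
    rcases hk with hk | rfl
    · exact rank_zero_iff_forall_zero.mp (ModularForm.levelOne_neg_weight_rank_zero hk) _
    · exact rank_zero_iff_forall_zero.mp ModularForm.levelOne_weight_two_rank_zero _
  simpa using congrArg DFunLike.coe this

lemma mdifferentiable_discriminant_zpow (n : ℤ) :
    MDifferentiable 𝓘(ℂ) 𝓘(ℂ) (fun τ => ModularForm.discriminant τ ^ n) :=
  UpperHalfPlane.mdifferentiable_iff.mpr <|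
    (UpperHalfPlane.mdifferentiable_iff.mp CuspForm.discriminant.holo').zpow
      (.inl fun _ _ => ModularForm.discriminant_ne_zero _)

lemma eq_of_hasQSeries_of_dvd {k k' ℓ a : ℤ} (hk' : k' < 12 ∨ k' = 14) (hk : k = 12 * ℓ + k')
    {p r : PowerSeries ℂ} {f g : UpperHalfPlane → ℂ}
    (hf : HasQSeries a p f) (hg : HasQSeries a r g)
    (hfhol : MDifferentiable 𝓘(ℂ) 𝓘(ℂ) f) (hghol : MDifferentiable 𝓘(ℂ) 𝓘(ℂ) g)
    (hfs : ∀ γ : SL(2, ℤ), f ∣[k] γ = f) (hgs : ∀ γ : SL(2, ℤ), g ∣[k] γ = g)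
    {d : ℕ} (had : a + d = ℓ + 1) (hd : PowerSeries.X ^ d ∣ p - r) : f = g := by
  obtain ⟨s, hs⟩ := hd
  have hfg := hf.sub hg
  rw [hs, HasQSeries.shift, had] at hfg
  obtain ⟨u, -, hu⟩ := exists_hasQSeries_discriminant_zpow
  have h := hfg.mul (hu (-(ℓ + 1)))
  rw [add_neg_cancel] at h
  have h0 := eq_zero_of_hasQSeries_of_slash_eq (k := k' - 12) (by lia)
    ((hfhol.sub hghol).mul (mdifferentiable_discriminant_zpow _)) (fun γ => ?_) h
  · funext τ
    simpa [ModularForm.discriminant_ne_zero, zpow_ne_zero, sub_eq_zero] using congrFun h0 τ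
  · refine slash_eq_self_iff.mpr fun τ => ?_
    have h1 := slash_eq_self_iff.mp (hfs γ) τ
    have h2 := slash_eq_self_iff.mp (hgs γ) τ
    have h3 := slash_eq_self_iff.mp (discriminant_slash γ) τ
    simp only [Pi.mul_apply, Pi.sub_apply, h1, h2, h3, mul_zpow, ← zpow_mul]
    rw [show k' - 12 = k + 12 * -(ℓ + 1) by lia, zpow_add₀ (denom_ne_zero _ _)]
    ring

/-- `f_{k,m} = Δ^ℓ E_{k'} F_{k,D}(j)` with `F_{k,D}` monic of degree `D = ℓ + m` over `ℤ`;
in particular all Fourier coefficients of `f_{k,m}` are integers. -/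
theorem stmt_3 (k ℓ k' : ℤ) (hk : Even k) (hk' : k' ∈ ({0, 4, 6, 8, 10, 14} : Set ℤ))
    (hdecomp : k = 12 * ℓ + k')
    (Δ : WhmForm ⊤ 12) (hΔ : IsBasisElt 12 1 (-1) Δ)
    (E : WhmForm ⊤ k') (hE : IsBasisElt k' 0 0 E)
    (J : WhmForm ⊤ 0) (hJ1 : J.coeff (-1) = 1) (hJ0 : J.coeff 0 = 744)
    (hJneg : ∀ n : ℤ, n < -1 → J.coeff n = 0)
    (m : ℤ) (hm : -ℓ ≤ m) (f : WhmForm ⊤ k) (hf : IsBasisElt k ℓ m f) :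
    (∃ F : Polynomial ℤ, F.Monic ∧ F.natDegree = (ℓ + m).toNat ∧
      ∀ τ : UpperHalfPlane, f.toFun τ =
        Δ.toFun τ ^ ℓ * E.toFun τ * (F.map (Int.castRingHom ℂ)).eval (J.toFun τ)) ∧
    ∀ n : ℤ, ∃ z : ℤ, f.coeff n = (z : ℂ) := by
  have hk'' : k' < 12 ∨ k' = 14 := by
    simp only [Set.mem_insert_iff, Set.mem_singleton_iff] at hk'
    lia
  obtain ⟨u, hu, hΔq⟩ := exists_hasQSeries_discriminant_zpow
  obtain ⟨e, he, hEq⟩ := E.exists_hasQSeries_eisenstein hk' hE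
  obtain ⟨j, hj, hJq⟩ := J.exists_hasQSeries_jInvariant hJ1 hJ0 hJneg
  have hv : PowerSeries.constantCoeff (((u ^ ℓ : (PowerSeries ℤ)ˣ) : PowerSeries ℤ) * e) = 1 := by
    rw [map_mul, hu, he, one_mul]
  obtain ⟨v, hveq⟩ : IsUnit (((u ^ ℓ : (PowerSeries ℤ)ˣ) : PowerSeries ℤ) * e) :=
    PowerSeries.isUnit_iff_constantCoeff.mpr (hv ▸ isUnit_one)
  obtain ⟨d, hd⟩ := Int.eq_ofNat_of_zero_le (show 0 ≤ ℓ + m by lia)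
  obtain ⟨F, hdeg, hlead, hF⟩ :=
    exists_polynomial_sum_congr hj d ((v⁻¹ : (PowerSeries ℤ)ˣ) : PowerSeries ℤ)
  have hvinv : PowerSeries.constantCoeff ((v⁻¹ : (PowerSeries ℤ)ˣ) : PowerSeries ℤ) = 1 := by
    have := congrArg PowerSeries.constantCoeff v.mul_inv
    rwa [map_mul, hveq, hv, one_mul, map_one] at this
  rw [hvinv] at hlead
  have hnat : F.natDegree = d :=
    hdeg.antisymm (Polynomial.le_natDegree_of_ne_zero (by simp [hlead]))
  have hGq := ((hΔq ℓ).mul hEq).mul (hJq.polynomial_eval hdeg)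
  rw [← map_mul, ← hveq, ← map_mul, show ℓ + 0 + -(d : ℤ) = -m by lia] at hGq
  have hfneg : ∀ n < -m, f.coeff n = 0 := fun n hn => hf.2 n hn.ne (by lia)
  have hfq := f.hasQSeries (-m) hfneg
  set S := ∑ i ∈ Finset.range (d + 1),
    PowerSeries.C (F.coeff i) * (PowerSeries.X ^ (d - i) * j ^ i)
  have hfG := eq_of_hasQSeries_of_dvd hk'' hdecomp hfq hGq f.holo ?_
    (fun γ => f.slash_eq γ trivial) (fun γ => ?_) (d := d + 1) (by push_cast; lia) ?_
  · refine ⟨⟨F, ?_, by lia, fun τ => ?_⟩, fun n => ?_⟩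
    · rw [Polynomial.Monic, Polynomial.leadingCoeff, hnat, hlead]
    · rw [Δ.eq_discriminant hΔ, congrFun hfG τ]
      rfl
    · by_cases hn : n < -m
      · exact ⟨0, by simp [hfneg n hn]⟩
      · have h := congrArg (PowerSeries.coeff (n + m).toNat) (hfq.unique (hfG ▸ hGq))
        refine ⟨(v * S : PowerSeries ℤ).coeff (n + m).toNat, ?_⟩
        rw [PowerSeries.coeff_mk, PowerSeries.coeff_map,
          show ((n + m).toNat : ℤ) + -m = n by lia] at h
        simpa using h
  · refine ((mdifferentiable_discriminant_zpow ℓ).mul E.holo).mul ?_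
    have h := (F.map (Int.castRingHom ℂ)).differentiable.comp_differentiableOn
      (UpperHalfPlane.mdifferentiable_iff.mp J.holo)
    exact UpperHalfPlane.mdifferentiable_iff.mpr h
  · refine slash_eq_self_iff.mpr fun τ => ?_
    have h1 := slash_eq_self_iff.mp (discriminant_slash γ) τ
    have h2 := slash_eq_self_iff.mp (E.slash_eq γ trivial) τ
    have h3 := slash_eq_self_iff.mp (J.slash_eq γ trivial) τ
    simp only [Pi.mul_apply, h1, h2, h3, zpow_zero, one_mul, mul_zpow, ← zpow_mul]
    rw [hdecomp, zpow_add₀ (denom_ne_zero _ _)]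
    ring
  · have hone : PowerSeries.X ^ (d + 1) ∣
        (PowerSeries.mk fun n : ℕ => f.coeff (n + -m)) - 1 := by
      refine PowerSeries.X_pow_dvd_iff.mpr fun n hn => ?_
      rw [map_sub, PowerSeries.coeff_mk, PowerSeries.coeff_one]
      rcases eq_or_ne n 0 with rfl | h0
      · simp [hf.1]
      · simp [h0, hf.2 (n + -m) (by lia) (by lia)]
    have hmul : PowerSeries.X ^ (d + 1) ∣ intSeries (v * S) - 1 := by
      obtain ⟨r, hr⟩ := hF
      refine ⟨intSeries (v * r), ?_⟩
      rw [← PowerSeries.map_X (Int.castRingHom ℂ), ← map_pow, ← map_mul, ← map_one intSeries,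
        ← map_sub]
      congr 1
      linear_combination (v : PowerSeries ℤ) * hr + v.mul_inv
    simpa using dvd_sub hone hmul
end
end
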